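/- arXiv:2402.05379 — 4 statements merged into one kernel-verified Lean document; each statement's English description precedes it below -/
import Mathlib

section
/- For every input x and parameter index i, the variance of the first diagonal FIM estimator satisfies (1/N)·‖∂_i h(x)‖₂⁴·λ̃_min(𝓜) ≤ 𝒱₁(θ_i|x) ≤ (1/N)·‖∂_i h(x)‖₂⁴·λ̃_max(𝓜), where 𝓜 is the 4-index tensor with entries 𝓜_{abcd} = K_{abcd}(t|x) − 𝓘_{ab}(h|x)·𝓘_{cd}(h|x). -/
open MeasureTheory ProbabilityTheory Matrix

noncomputable section

namespace FIMPaper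

variable {Y : Type*} [MeasurableSpace Y] {T : ℕ}

/-- Mean `η` of the sufficient statistic `t` under a distribution `μ` (= `p(y|x)` for fixed x). -/
def meanT (μ : Measure Y) (t : Y → Fin T → ℝ) (a : Fin T) : ℝ := ∫ y, t y a ∂μ

/-- Covariance matrix `𝓘(h|x)` of the sufficient statistic `t` under `μ`. -/
def covT (μ : Measure Y) (t : Y → Fin T → ℝ) : Matrix (Fin T) (Fin T) ℝ :=
  Matrix.of fun a b => ∫ y, (t y a - meanT μ t a) * (t y b - meanT μ t b) ∂μ

lemma covT_isHermitian (μ : Measure Y) (t : Y → Fin T → ℝ) : (covT μ t).IsHermitian := by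
  show (covT μ t)ᴴ = covT μ t
  ext a b
  simp only [Matrix.conjTranspose_apply, covT, Matrix.of_apply, star_trivial]
  exact integral_congr_ae (Filter.Eventually.of_forall fun y => mul_comm _ _)

/-- Fourth central moment tensor `K(t|x)` of the sufficient statistic `t` under `μ`. -/
def K4 (μ : Measure Y) (t : Y → Fin T → ℝ) (a b c d : Fin T) : ℝ :=
  ∫ y, (t y a - meanT μ t a) * (t y b - meanT μ t b) * (t y c - meanT μ t c) *
    (t y d - meanT μ t d) ∂μ

/-- Maximum eigenvalue `λ_max` of a symmetric (Hermitian) real matrix. -/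
def lamMax {n : Type*} [Fintype n] [DecidableEq n] {A : Matrix n n ℝ}
    (hA : A.IsHermitian) : ℝ := ⨆ i, hA.eigenvalues i

/-- Minimum eigenvalue `λ_min` of a symmetric (Hermitian) real matrix. -/
def lamMin {n : Type*} [Fintype n] [DecidableEq n] {A : Matrix n n ℝ}
    (hA : A.IsHermitian) : ℝ := ⨅ i, hA.eigenvalues i

/-- Minimum (Z-)eigenvalue `λ̃_min` of a 4-index tensor, defined variationally. -/
def tlamMin (𝒯 : Fin T → Fin T → Fin T → Fin T → ℝ) : ℝ :=
  sInf {r | ∃ u : Fin T → ℝ, ∑ a, u a ^ 2 = 1 ∧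
    r = ∑ a, ∑ b, ∑ c, ∑ d, u a * u b * u c * u d * 𝒯 a b c d}

/-- Maximum (Z-)eigenvalue `λ̃_max` of a 4-index tensor, defined variationally. -/
def tlamMax (𝒯 : Fin T → Fin T → Fin T → Fin T → ℝ) : ℝ :=
  sSup {r | ∃ u : Fin T → ℝ, ∑ a, u a ^ 2 = 1 ∧
    r = ∑ a, ∑ b, ∑ c, ∑ d, u a * u b * u c * u d * 𝒯 a b c d}

/-- Eigenvalues of a Hermitian matrix sorted in ascending order. -/
def eigAsc {n : Type*} [Fintype n] [DecidableEq n] {A : Matrix n n ℝ}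
    (hA : A.IsHermitian) : Fin (Fintype.card n) → ℝ :=
  fun i =>
    (fun j => hA.eigenvalues ((Fintype.equivFin n).symm j)) ∘
      (Tuple.sort fun j => hA.eigenvalues ((Fintype.equivFin n).symm j)) <| i

/-- Eigenvalues of a Hermitian matrix sorted in descending order:
`eigDesc hA t` is the `t`-th largest eigenvalue (0-indexed). -/
def eigDesc {n : Type*} [Fintype n] [DecidableEq n] {A : Matrix n n ℝ}
    (hA : A.IsHermitian) : Fin (Fintype.card n) → ℝ :=
  fun i => eigAsc hA i.rev


/-- The quartic form of a 4-index tensor. -/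
def quarticForm (𝒯 : Fin T → Fin T → Fin T → Fin T → ℝ) (u : Fin T → ℝ) : ℝ :=
  ∑ a, ∑ b, ∑ c, ∑ d, u a * u b * u c * u d * 𝒯 a b c d

lemma quarticForm_smul (𝒯 : Fin T → Fin T → Fin T → Fin T → ℝ) (r : ℝ) (u : Fin T → ℝ) :
    quarticForm 𝒯 (r • u) = r ^ 4 * quarticForm 𝒯 u := by
  simp only [quarticForm, Finset.mul_sum, Pi.smul_apply, smul_eq_mul]
  congr! 4
  ring

lemma abs_quarticForm_le (𝒯 : Fin T → Fin T → Fin T → Fin T → ℝ) {u : Fin T → ℝ}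
    (hu : ∑ a, u a ^ 2 = 1) :
    |quarticForm 𝒯 u| ≤ ∑ a, ∑ b, ∑ c, ∑ d, |𝒯 a b c d| := by
  have hu1 (a : Fin T) : |u a| ≤ 1 := by
    rw [← sq_le_one_iff_abs_le_one, ← hu]
    exact Finset.single_le_sum (fun b _ => sq_nonneg (u b)) (Finset.mem_univ a)
  unfold quarticForm
  refine (Finset.abs_sum_le_sum_abs _ _).trans (Finset.sum_le_sum fun a _ => ?_)
  refine (Finset.abs_sum_le_sum_abs _ _).trans (Finset.sum_le_sum fun b _ => ?_)
  refine (Finset.abs_sum_le_sum_abs _ _).trans (Finset.sum_le_sum fun c _ => ?_)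
  refine (Finset.abs_sum_le_sum_abs _ _).trans (Finset.sum_le_sum fun d _ => ?_)
  simp only [abs_mul]
  refine mul_le_of_le_one_left (abs_nonneg _) ?_
  exact mul_le_one₀ (mul_le_one₀ (mul_le_one₀ (hu1 a) (abs_nonneg _) (hu1 b))
    (abs_nonneg _) (hu1 c)) (abs_nonneg _) (hu1 d)

lemma tlamMin_le_quarticForm (𝒯 : Fin T → Fin T → Fin T → Fin T → ℝ) {u : Fin T → ℝ}
    (hu : ∑ a, u a ^ 2 = 1) : tlamMin 𝒯 ≤ quarticForm 𝒯 u :=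
  csInf_le ⟨-∑ a, ∑ b, ∑ c, ∑ d, |𝒯 a b c d|, by
    rintro _ ⟨v, hv, rfl⟩
    exact (abs_le.1 (abs_quarticForm_le 𝒯 hv)).1⟩ ⟨u, hu, rfl⟩

lemma quarticForm_le_tlamMax (𝒯 : Fin T → Fin T → Fin T → Fin T → ℝ) {u : Fin T → ℝ}
    (hu : ∑ a, u a ^ 2 = 1) : quarticForm 𝒯 u ≤ tlamMax 𝒯 :=
  le_csSup ⟨∑ a, ∑ b, ∑ c, ∑ d, |𝒯 a b c d|, by
    rintro _ ⟨v, hv, rfl⟩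
    exact (abs_le.1 (abs_quarticForm_le 𝒯 hv)).2⟩ ⟨u, hu, rfl⟩

lemma quarticForm_bounds (𝒯 : Fin T → Fin T → Fin T → Fin T → ℝ) (v : Fin T → ℝ) :
    (∑ a, v a ^ 2) ^ 2 * tlamMin 𝒯 ≤ quarticForm 𝒯 v ∧
      quarticForm 𝒯 v ≤ (∑ a, v a ^ 2) ^ 2 * tlamMax 𝒯 := by
  obtain hs | hs := (Finset.sum_nonneg fun a _ => sq_nonneg (v a) :
    0 ≤ ∑ a, v a ^ 2).eq_or_lt'
  · have hv : ∀ a, v a = 0 := by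
      simpa [Finset.sum_eq_zero_iff_of_nonneg, sq_nonneg] using hs
    simp [quarticForm, hv]
  set r := √(∑ a, v a ^ 2) with hr
  have hr0 : r ≠ 0 := (Real.sqrt_pos.2 hs).ne'
  have hr2 : ∑ a, v a ^ 2 = r ^ 2 := (Real.sq_sqrt hs.le).symm
  have hu : ∑ a, (r⁻¹ • v) a ^ 2 = 1 := by
    simp only [Pi.smul_apply, smul_eq_mul, mul_pow, ← Finset.mul_sum]
    rw [hr2, ← mul_pow, inv_mul_cancel₀ hr0, one_pow]
  have hQ : quarticForm 𝒯 v = (∑ a, v a ^ 2) ^ 2 * quarticForm 𝒯 (r⁻¹ • v) := by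
    rw [hr2, ← pow_mul, ← quarticForm_smul, smul_inv_smul₀ hr0]
  rw [hQ]
  exact ⟨mul_le_mul_of_nonneg_left (tlamMin_le_quarticForm 𝒯 hu) (sq_nonneg _),
    mul_le_mul_of_nonneg_left (quarticForm_le_tlamMax 𝒯 hu) (sq_nonneg _)⟩

lemma sum_mul_sq (v s : Fin T → ℝ) :
    (∑ a, v a * s a) ^ 2 = ∑ a, ∑ b, v a * v b * (s a * s b) := by
  rw [sq, Finset.sum_mul_sum]
  congr! 2
  ring

lemma sum_mul_pow_four (v s : Fin T → ℝ) :
    (∑ a, v a * s a) ^ 4 =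
      ∑ a, ∑ b, ∑ c, ∑ d, v a * v b * v c * v d * (s a * s b * s c * s d) := by
  simp only [pow_succ', pow_zero, mul_one, Finset.sum_mul_sum]
  simp only [Finset.mul_sum]
  congr! 4
  ring

/-- The variance of the square of a linear form in the centred statistic is a quartic form. -/
lemma variance_sq_linear_eq_quarticForm (μ : Measure Y) [IsProbabilityMeasure μ]
    (t : Y → Fin T → ℝ)
    (ht2 : ∀ a b, MemLp (fun y => (t y a - meanT μ t a) * (t y b - meanT μ t b)) 2 μ)
    (ht4 : ∀ a b c d : Fin T, Integrable (fun y =>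
      (t y a - meanT μ t a) * (t y b - meanT μ t b) *
      (t y c - meanT μ t c) * (t y d - meanT μ t d)) μ) (v : Fin T → ℝ)
    (hg : MemLp (fun y => (∑ a, v a * (t y a - meanT μ t a)) ^ 2) 2 μ) :
    variance (fun y => (∑ a, v a * (t y a - meanT μ t a)) ^ 2) μ =
      quarticForm (fun a b c d => K4 μ t a b c d - covT μ t a b * covT μ t c d) v := by
  have hfst : ∫ y, (∑ a, v a * (t y a - meanT μ t a)) ^ 2 ∂μ =
      ∑ a, ∑ b, v a * v b * covT μ t a b := by
    have hi (a b : Fin T) := ((ht2 a b).integrable one_le_two).const_mul (v a * v b)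
    simp only [sum_mul_sq]
    rw [integral_finsetSum _ fun a _ => integrable_finsetSum _ fun b _ => hi a b]
    congr! 1 with a
    rw [integral_finsetSum _ fun b _ => hi a b]
    simp only [integral_const_mul, covT, Matrix.of_apply]
  have hsnd : ∫ y, (∑ a, v a * (t y a - meanT μ t a)) ^ 4 ∂μ =
      ∑ a, ∑ b, ∑ c, ∑ d, v a * v b * v c * v d * K4 μ t a b c d := by
    have hi (a b c d : Fin T) := (ht4 a b c d).const_mul (v a * v b * v c * v d)
    simp only [sum_mul_pow_four]
    rw [integral_finsetSum _ fun a _ => integrable_finsetSum _ fun b _ =>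
      integrable_finsetSum _ fun c _ => integrable_finsetSum _ fun d _ => hi a b c d]
    congr! 1 with a
    rw [integral_finsetSum _ fun b _ =>
      integrable_finsetSum _ fun c _ => integrable_finsetSum _ fun d _ => hi a b c d]
    congr! 1 with b
    rw [integral_finsetSum _ fun c _ => integrable_finsetSum _ fun d _ => hi a b c d]
    congr! 1 with c
    rw [integral_finsetSum _ fun d _ => hi a b c d]
    simp only [integral_const_mul, K4]
  rw [variance_eq_sub hg, hfst]
  simp only [Pi.pow_apply, ← pow_mul]
  rw [hsnd, sq]
  simp only [quarticForm, mul_sub, Finset.sum_sub_distrib, Finset.sum_mul]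
  simp only [Finset.mul_sum]
  congr! 5
  ring

lemma variance_average_pi {N : ℕ} (hN : 0 < N) (μ : Measure Y) [IsProbabilityMeasure μ]
    {g : Y → ℝ} (hg : MemLp g 2 μ) :
    variance (fun ys : Fin N → Y => (N : ℝ)⁻¹ * ∑ k, g (ys k)) (Measure.pi fun _ => μ) =
      (N : ℝ)⁻¹ * variance g μ := by
  have hN0 : (N : ℝ) ≠ 0 := Nat.cast_ne_zero.2 hN.ne'
  have hsum := variance_sum_pi (μ := fun _ : Fin N => μ) (X := fun _ => g) fun _ => hg
  have hfun : (∑ k : Fin N, fun ys : Fin N → Y => g (ys k)) = fun ys => ∑ k, g (ys k) := by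
    ext ys
    simp
  rw [hfun] at hsum
  rw [variance_const_mul, hsum]
  simp
  field_simp

/-- For the first diagonal FIM estimator
`Î₁(θ_i|x) = (1/N) ∑_k (∂_i F(h(x)) - ∂_i h(x)ᵀ t(y_k))²` based on `N` i.i.d. samples
`y_1, …, y_N ~ p(y|x)`, its variance `𝒱₁(θ_i|x)` satisfies
`(1/N)‖∂_i h(x)‖₂⁴ λ̃_min(𝓜) ≤ 𝒱₁(θ_i|x) ≤ (1/N)‖∂_i h(x)‖₂⁴ λ̃_max(𝓜)` where
`𝓜_{abcd} = K_{abcd}(t|x) - 𝓘_{ab}(h|x)𝓘_{cd}(h|x)`.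
`dh x i a = ∂ h^a(x)/∂θ_i`, and `dF x i = ∂_i F(h(x))`, which for exponential families equals
`η(x)ᵀ ∂_i h(x)`. -/
theorem variance_estimator_one_bounds
    {X Y : Type*} [MeasurableSpace Y] {T dimθ N : ℕ} (hN : 0 < N)
    (p : X → Measure Y) (hp : ∀ x, IsProbabilityMeasure (p x))
    (t : Y → Fin T → ℝ) (ht : Measurable t)
    (ht4 : ∀ (x : X) (a b c d : Fin T), Integrable (fun y =>
      (t y a - meanT (p x) t a) * (t y b - meanT (p x) t b) *
      (t y c - meanT (p x) t c) * (t y d - meanT (p x) t d)) (p x))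
    (dh : X → Fin dimθ → Fin T → ℝ)
    (dF : X → Fin dimθ → ℝ)
    (hdF : ∀ x i, dF x i = ∑ a, meanT (p x) t a * dh x i a) :
    ∀ (x : X) (i : Fin dimθ),
      (N : ℝ)⁻¹ * (∑ a, dh x i a ^ 2) ^ 2 *
          tlamMin (fun a b c d =>
            K4 (p x) t a b c d - covT (p x) t a b * covT (p x) t c d) ≤
        variance
          (fun ys : Fin N → Y => (N : ℝ)⁻¹ * ∑ k, (dF x i - ∑ a, dh x i a * t (ys k) a) ^ 2)
          (Measure.pi fun _ => p x) ∧
      variance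
          (fun ys : Fin N → Y => (N : ℝ)⁻¹ * ∑ k, (dF x i - ∑ a, dh x i a * t (ys k) a) ^ 2)
          (Measure.pi fun _ => p x) ≤
        (N : ℝ)⁻¹ * (∑ a, dh x i a ^ 2) ^ 2 *
          tlamMax (fun a b c d =>
            K4 (p x) t a b c d - covT (p x) t a b * covT (p x) t c d) := by
  intro x i
  have := hp x
  have ht2 (a b : Fin T) :
      MemLp (fun y => (t y a - meanT (p x) t a) * (t y b - meanT (p x) t b)) 2 (p x) := by
    refine (memLp_two_iff_integrable_sq (by fun_prop)).2 ((ht4 x a b a b).congr ?_)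
    filter_upwards with y
    ring
  have hg : MemLp (fun y => (∑ a, dh x i a * (t y a - meanT (p x) t a)) ^ 2) 2 (p x) := by
    simp only [sum_mul_sq]
    exact memLp_finsetSum _ fun a _ => memLp_finsetSum _ fun b _ => (ht2 a b).const_mul _
  have hlin (y : Y) : (dF x i - ∑ a, dh x i a * t y a) ^ 2 =
      (∑ a, dh x i a * (t y a - meanT (p x) t a)) ^ 2 := by
    simp only [hdF, mul_sub, Finset.sum_sub_distrib, mul_comm (meanT (p x) t _)]
    ring
  simp only [hlin]
  rw [variance_average_pi hN (p x) hg,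
    variance_sq_linear_eq_quarticForm (p x) t ht2 (ht4 x) (dh x i) hg, mul_assoc, mul_assoc]
  obtain ⟨hmin, hmax⟩ := quarticForm_bounds
    (fun a b c d => K4 (p x) t a b c d - covT (p x) t a b * covT (p x) t c d) (dh x i)
  exact ⟨by gcongr, by gcongr⟩

end FIMPaper
end
end

section
/- Suppose ‖t(y) − η(x)‖₂² ≤ B holds p(y|x)-almost surely. Then λ̃_max(K(t|x)) ≤ B·λ_max(𝓘(h|x)) ≤ B². -/
open MeasureTheory ProbabilityTheory Matrix

noncomputable section

namespace FIMPaper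

variable {Y : Type*} [MeasurableSpace Y] {T : ℕ}

lemma eigenvalues_le_lamMax {n : Type*} [Fintype n] [DecidableEq n] {A : Matrix n n ℝ}
    (hA : A.IsHermitian) (i : n) : hA.eigenvalues i ≤ lamMax hA :=
  le_ciSup (Set.finite_range _).bddAbove i

/-- Rayleigh bound: the quadratic form of a Hermitian matrix is at most `λ_max` times the squared
Euclidean norm. -/
lemma dotProduct_mulVec_le_lamMax {n : Type*} [Fintype n] [DecidableEq n] {A : Matrix n n ℝ}
    (hA : A.IsHermitian) (u : n → ℝ) : u ⬝ᵥ A *ᵥ u ≤ lamMax hA * ∑ a, u a ^ 2 := by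
  set b := hA.eigenvectorBasis
  set x : EuclideanSpace ℝ n := WithLp.toLp 2 u
  have hcoord (i : n) :
      inner ℝ (b i) (WithLp.toLp 2 (A *ᵥ u)) = hA.eigenvalues i * inner ℝ (b i) x := by
    have hsymm : Aᵀ = A := by simpa [conjTranspose_eq_transpose_of_trivial] using hA.eq
    calc inner ℝ (b i) (WithLp.toLp 2 (A *ᵥ u)) = (A *ᵥ u) ⬝ᵥ ⇑(b i) := by
          simp [EuclideanSpace.inner_eq_star_dotProduct]
      _ = u ⬝ᵥ A *ᵥ ⇑(b i) := by
          rw [dotProduct_mulVec, ← mulVec_transpose, hsymm]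
      _ = hA.eigenvalues i * inner ℝ (b i) x := by
          rw [hA.mulVec_eigenvectorBasis]
          simp [EuclideanSpace.inner_eq_star_dotProduct, x, b]
  have hnorm : ∑ i, inner ℝ (b i) x ^ 2 = ∑ a, u a ^ 2 := by
    rw [b.sum_sq_inner_right, EuclideanSpace.real_norm_sq_eq]
  calc u ⬝ᵥ A *ᵥ u = inner ℝ x (WithLp.toLp 2 (A *ᵥ u)) := by
        simp [EuclideanSpace.inner_eq_star_dotProduct, x, dotProduct_comm]
    _ = ∑ i, hA.eigenvalues i * inner ℝ (b i) x ^ 2 := by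
        rw [← b.sum_inner_mul_inner]
        refine Finset.sum_congr rfl fun i _ => ?_
        rw [hcoord, real_inner_comm]
        ring
    _ ≤ ∑ i, lamMax hA * inner ℝ (b i) x ^ 2 := by
        gcongr with i
        exact eigenvalues_le_lamMax hA i
    _ = lamMax hA * ∑ a, u a ^ 2 := by rw [← Finset.mul_sum, hnorm]

lemma sq_sum_mul_eq (u z : Fin T → ℝ) :
    (∑ a, u a * z a) ^ 2 = ∑ a, ∑ b, u a * u b * (z a * z b) := by
  rw [sq, Finset.sum_mul_sum]
  exact Finset.sum_congr rfl fun a _ => Finset.sum_congr rfl fun b _ => by ring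

lemma pow_four_sum_mul_eq (u z : Fin T → ℝ) :
    (∑ a, u a * z a) ^ 4 =
      ∑ a, ∑ b, ∑ c, ∑ d, u a * u b * u c * u d * (z a * z b * z c * z d) := by
  have h : (∑ a, u a * z a) ^ 4 =
      (∑ a, u a * z a) * ((∑ a, u a * z a) * ((∑ a, u a * z a) * ∑ a, u a * z a)) := by ring
  rw [h, Finset.sum_mul]
  refine Finset.sum_congr rfl fun a _ => ?_
  rw [Finset.sum_mul, Finset.mul_sum]
  refine Finset.sum_congr rfl fun b _ => ?_
  rw [Finset.sum_mul, Finset.mul_sum, Finset.mul_sum]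
  refine Finset.sum_congr rfl fun c _ => ?_
  rw [Finset.mul_sum, Finset.mul_sum, Finset.mul_sum]
  exact Finset.sum_congr rfl fun d _ => by ring

lemma integrable_sq_sum_mul {μ : Measure Y} {z : Y → Fin T → ℝ}
    (hz : ∀ a b, Integrable (fun y => z y a * z y b) μ) (u : Fin T → ℝ) :
    Integrable (fun y => (∑ a, u a * z y a) ^ 2) μ := by
  simp only [sq_sum_mul_eq]
  exact integrable_finsetSum _ fun a _ => integrable_finsetSum _ fun b _ => (hz a b).const_mul _

lemma integrable_pow_four_sum_mul {μ : Measure Y} {z : Y → Fin T → ℝ}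
    (hz : ∀ a b c d, Integrable (fun y => z y a * z y b * z y c * z y d) μ) (u : Fin T → ℝ) :
    Integrable (fun y => (∑ a, u a * z y a) ^ 4) μ := by
  simp only [pow_four_sum_mul_eq]
  exact integrable_finsetSum _ fun a _ => integrable_finsetSum _ fun b _ =>
    integrable_finsetSum _ fun c _ => integrable_finsetSum _ fun d _ => (hz a b c d).const_mul _

/-- The quadratic form of the covariance matrix is the variance of the projected statistic. -/
lemma dotProduct_covT_mulVec {μ : Measure Y} {t : Y → Fin T → ℝ}
    (ht2 : ∀ a b : Fin T, Integrable (fun y =>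
      (t y a - meanT μ t a) * (t y b - meanT μ t b)) μ) (u : Fin T → ℝ) :
    u ⬝ᵥ covT μ t *ᵥ u = ∫ y, (∑ a, u a * (t y a - meanT μ t a)) ^ 2 ∂μ := by
  have hint (a b : Fin T) := (ht2 a b).const_mul (u a * u b)
  simp only [fun y => sq_sum_mul_eq u fun a => t y a - meanT μ t a]
  rw [integral_finsetSum _ fun a _ => integrable_finsetSum _ fun b _ => hint a b]
  simp only [dotProduct, mulVec, covT, of_apply, Finset.mul_sum]
  refine Finset.sum_congr rfl fun a _ => ?_
  rw [integral_finsetSum _ fun b _ => hint a b]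
  refine Finset.sum_congr rfl fun b _ => ?_
  rw [integral_const_mul]
  ring

/-- The quartic form of the fourth central moment tensor is the fourth central moment of the
projected statistic. -/
lemma sum_mul_K4 {μ : Measure Y} {t : Y → Fin T → ℝ}
    (ht4 : ∀ a b c d : Fin T, Integrable (fun y =>
      (t y a - meanT μ t a) * (t y b - meanT μ t b) *
      (t y c - meanT μ t c) * (t y d - meanT μ t d)) μ) (u : Fin T → ℝ) :
    ∑ a, ∑ b, ∑ c, ∑ d, u a * u b * u c * u d * K4 μ t a b c d =
      ∫ y, (∑ a, u a * (t y a - meanT μ t a)) ^ 4 ∂μ := by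
  have h4 (a b c d : Fin T) := (ht4 a b c d).const_mul (u a * u b * u c * u d)
  have h3 (a b c : Fin T) := integrable_finsetSum Finset.univ fun d _ => h4 a b c d
  have h2 (a b : Fin T) := integrable_finsetSum Finset.univ fun c _ => h3 a b c
  have h1 (a : Fin T) := integrable_finsetSum Finset.univ fun b _ => h2 a b
  simp only [fun y => pow_four_sum_mul_eq u fun a => t y a - meanT μ t a]
  rw [integral_finsetSum _ fun a _ => h1 a]
  refine Finset.sum_congr rfl fun a _ => ?_
  rw [integral_finsetSum _ fun b _ => h2 a b]
  refine Finset.sum_congr rfl fun b _ => ?_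
  rw [integral_finsetSum _ fun c _ => h3 a b c]
  refine Finset.sum_congr rfl fun c _ => ?_
  rw [integral_finsetSum _ fun d _ => h4 a b c d]
  refine Finset.sum_congr rfl fun d _ => ?_
  rw [integral_const_mul, K4]

lemma eigenvalues_covT_eq_integral {μ : Measure Y} {t : Y → Fin T → ℝ}
    (ht2 : ∀ a b : Fin T, Integrable (fun y =>
      (t y a - meanT μ t a) * (t y b - meanT μ t b)) μ) (i : Fin T) :
    (covT_isHermitian μ t).eigenvalues i =
      ∫ y, (∑ a, (covT_isHermitian μ t).eigenvectorBasis i a * (t y a - meanT μ t a)) ^ 2 ∂μ := by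
  rw [← dotProduct_covT_mulVec ht2, (covT_isHermitian μ t).eigenvalues_eq]
  simp

lemma sq_sum_mul_le {u z : Fin T → ℝ} {B : ℝ} (hu : ∑ a, u a ^ 2 = 1)
    (hz : ∑ a, z a ^ 2 ≤ B) : (∑ a, u a * z a) ^ 2 ≤ B :=
  (Finset.sum_mul_sq_le_sq_mul_sq _ u z).trans (by rwa [hu, one_mul])

/-- If `‖t(y) − η(x)‖₂² ≤ B` holds `p(y|x)`-almost surely, then
`λ̃_max(K(t|x)) ≤ B·λ_max(𝓘(h|x)) ≤ B²`.  Here `μ` plays the role of the conditional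
distribution `p(·|x)` for the fixed input `x`. -/
theorem bounded_sufficient_statistic_bound
    {Y : Type*} [MeasurableSpace Y] {T : ℕ}
    (μ : Measure Y) (hμ : IsProbabilityMeasure μ)
    (t : Y → Fin T → ℝ) (ht : Measurable t)
    (ht1 : ∀ a : Fin T, Integrable (fun y => t y a) μ)
    (ht2 : ∀ a b : Fin T, Integrable (fun y =>
      (t y a - meanT μ t a) * (t y b - meanT μ t b)) μ)
    (ht4 : ∀ a b c d : Fin T, Integrable (fun y =>
      (t y a - meanT μ t a) * (t y b - meanT μ t b) *
      (t y c - meanT μ t c) * (t y d - meanT μ t d)) μ)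
    (B : ℝ)
    (hB : ∀ᵐ y ∂μ, (∑ a, (t y a - meanT μ t a) ^ 2) ≤ B) :
    tlamMax (K4 μ t) ≤ B * lamMax (covT_isHermitian μ t) ∧
    B * lamMax (covT_isHermitian μ t) ≤ B ^ 2 := by
  have hB0 : 0 ≤ B := by
    obtain ⟨y, hy⟩ := hB.exists
    exact (Finset.sum_nonneg fun a _ => sq_nonneg _).trans hy
  have hlam0 : 0 ≤ lamMax (covT_isHermitian μ t) := Real.iSup_nonneg fun i => by
    rw [eigenvalues_covT_eq_integral ht2]
    exact integral_nonneg fun y => sq_nonneg _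
  have hlamB : lamMax (covT_isHermitian μ t) ≤ B := by
    refine Real.iSup_le (fun i => ?_) hB0
    rw [eigenvalues_covT_eq_integral ht2]
    set v := (covT_isHermitian μ t).eigenvectorBasis i with hv
    have hv1 : ∑ a, v a ^ 2 = 1 := by
      rw [← EuclideanSpace.real_norm_sq_eq, hv, OrthonormalBasis.norm_eq_one, one_pow]
    calc ∫ y, (∑ a, v a * (t y a - meanT μ t a)) ^ 2 ∂μ ≤ ∫ _, B ∂μ := by
          refine integral_mono_ae (integrable_sq_sum_mul ht2 _) (integrable_const B) ?_
          filter_upwards [hB] with y hy using sq_sum_mul_le hv1 hy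
      _ = B := by simp
  refine ⟨Real.sSup_le ?_ (mul_nonneg hB0 hlam0), ?_⟩
  · rintro r ⟨u, hu, rfl⟩
    rw [sum_mul_K4 ht4]
    calc ∫ y, (∑ a, u a * (t y a - meanT μ t a)) ^ 4 ∂μ
        ≤ ∫ y, B * (∑ a, u a * (t y a - meanT μ t a)) ^ 2 ∂μ := by
          refine integral_mono_ae (integrable_pow_four_sum_mul ht4 _)
            ((integrable_sq_sum_mul ht2 _).const_mul B) ?_
          filter_upwards [hB] with y hy
          have hsq := mul_le_mul_of_nonneg_right (sq_sum_mul_le hu hy)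
            (sq_nonneg (∑ a, u a * (t y a - meanT μ t a)))
          linarith
      _ = B * (u ⬝ᵥ covT μ t *ᵥ u) := by
          rw [integral_const_mul, dotProduct_covT_mulVec ht2]
      _ ≤ B * lamMax (covT_isHermitian μ t) := by
          have hray := dotProduct_mulVec_le_lamMax (covT_isHermitian μ t) u
          rw [hu, mul_one] at hray
          exact mul_le_mul_of_nonneg_left hray hB0
  · rw [sq]
    exact mul_le_mul_of_nonneg_left hlamB hB0

end FIMPaper
end
end

section
/- Suppose the exponential family is the categorical distribution over C classes with one-hot sufficient statistics. With σ(x) = SoftMax(h(x)), σ_max(x) = max_k σ_k(x) and m(x) := min{σ_max(x), 1 − ‖σ(x)‖₂²}, it holds that λ_max(𝓘(h|x)) ≤ m(x) and λ̃_max(K(t|x) − 𝓘(h|x)⊗𝓘(h|x)) ≤ 2·m(x). -/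
open MeasureTheory ProbabilityTheory Matrix

noncomputable section

namespace FIMPaper

variable {Y : Type*} [MeasurableSpace Y] {T : ℕ}

/-- Softmax of the logits `h`. -/
def softmax {C : ℕ} (h : Fin C → ℝ) (k : Fin C) : ℝ :=
  Real.exp (h k) / ∑ j, Real.exp (h j)

/-- Covariance matrix `𝓘(h|x) = diag(σ) − σσᵀ` of the one-hot sufficient statistic of a
categorical distribution with class probabilities `σ`. -/
def catCov {C : ℕ} (σ : Fin C → ℝ) : Matrix (Fin C) (Fin C) ℝ :=
  Matrix.of fun a b => (if a = b then σ a else 0) - σ a * σ b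

lemma catCov_isHermitian {C : ℕ} (σ : Fin C → ℝ) : (catCov σ).IsHermitian := by
  show (catCov σ)ᴴ = catCov σ
  ext a b
  simp only [Matrix.conjTranspose_apply, catCov, Matrix.of_apply, star_trivial]
  by_cases hab : b = a
  · subst hab; ring
  · rw [if_neg hab, if_neg fun hba => hab hba.symm]
    ring

/-- Fourth central moment tensor `K(t|x)` of the one-hot sufficient statistic
`t(y) = (⟦y=1⟧,…,⟦y=C⟧)` of a categorical distribution with class probabilities `σ`. -/
def catK4 {C : ℕ} (σ : Fin C → ℝ) (a b c d : Fin C) : ℝ :=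
  ∑ k, σ k *
    (((if k = a then (1 : ℝ) else 0) - σ a) * ((if k = b then (1 : ℝ) else 0) - σ b) *
      ((if k = c then (1 : ℝ) else 0) - σ c) * ((if k = d then (1 : ℝ) else 0) - σ d))

lemma softmax_nonneg {C : ℕ} (h : Fin C → ℝ) (k : Fin C) : 0 ≤ softmax h k := by
  unfold softmax
  positivity

lemma sum_softmax {C : ℕ} [NeZero C] (h : Fin C → ℝ) : ∑ k, softmax h k = 1 := by
  unfold softmax
  rw [← Finset.sum_div]
  exact div_self (Finset.sum_pos (fun j _ => Real.exp_pos _) Finset.univ_nonempty).ne'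

lemma sum_mul_one_hot_sub {C : ℕ} (σ u : Fin C → ℝ) (k : Fin C) :
    ∑ a, u a * ((if k = a then (1 : ℝ) else 0) - σ a) = u k - ∑ a, σ a * u a := by
  simp [mul_sub, Finset.sum_sub_distrib, mul_comm]

lemma sum_mul_sub_mean_sq {C : ℕ} {σ : Fin C → ℝ} (hσ : ∑ k, σ k = 1) (u : Fin C → ℝ) :
    ∑ k, σ k * (u k - ∑ a, σ a * u a) ^ 2 = ∑ k, σ k * u k ^ 2 - (∑ a, σ a * u a) ^ 2 := by
  have hs (s : ℝ) : ∑ k, σ k * (u k - s) ^ 2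
      = ∑ k, σ k * u k ^ 2 - 2 * s * ∑ a, σ a * u a + s ^ 2 * ∑ k, σ k := by
    rw [Finset.mul_sum, Finset.mul_sum, ← Finset.sum_sub_distrib, ← Finset.sum_add_distrib]
    exact Finset.sum_congr rfl fun k _ => by ring
  rw [hs, hσ]
  ring

/-- The quadratic form of `catCov σ` is the variance of `u` under `σ`. -/
lemma dotProduct_catCov_mulVec {C : ℕ} {σ : Fin C → ℝ} (hσ : ∑ k, σ k = 1) (u : Fin C → ℝ) :
    u ⬝ᵥ (catCov σ *ᵥ u) = ∑ k, σ k * (u k - ∑ a, σ a * u a) ^ 2 := by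
  have hrow (a : Fin C) : (catCov σ *ᵥ u) a = σ a * u a - σ a * ∑ b, σ b * u b := by
    simp [mulVec, dotProduct, catCov, sub_mul, Finset.sum_sub_distrib, Finset.mul_sum, mul_assoc]
  rw [sum_mul_sub_mean_sq hσ]
  simp only [dotProduct, hrow, mul_sub, Finset.sum_sub_distrib]
  rw [sq (∑ a, σ a * u a), Finset.sum_mul]
  congr 1 <;> exact Finset.sum_congr rfl fun a _ => by ring

lemma sq_sub_mean_le {C : ℕ} (σ : Fin C → ℝ) {u : Fin C → ℝ} (hu : ∑ a, u a ^ 2 = 1)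
    (k : Fin C) :
    (u k - ∑ a, σ a * u a) ^ 2 ≤ 1 - 2 * σ k + ∑ a, σ a ^ 2 := by
  rw [← sum_mul_one_hot_sub]
  refine (Finset.sum_mul_sq_le_sq_mul_sq _ _ _).trans_eq ?_
  rw [hu, one_mul]
  simp [sub_sq, Finset.sum_add_distrib, Finset.sum_sub_distrib]

lemma sum_sq_le_one {C : ℕ} {σ : Fin C → ℝ} (h0 : ∀ k, 0 ≤ σ k) (hσ : ∑ k, σ k = 1) :
    ∑ k, σ k ^ 2 ≤ 1 := by
  simpa [hσ] using Finset.sum_sq_le_sq_sum_of_nonneg (s := Finset.univ) fun k _ => h0 k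

/-- The variance of a unit vector under `σ` is at most both the largest probability and
`1 - ‖σ‖²`. -/
lemma variance_le_min {C : ℕ} {σ : Fin C → ℝ} (h0 : ∀ k, 0 ≤ σ k) (hσ : ∑ k, σ k = 1)
    {u : Fin C → ℝ} (hu : ∑ a, u a ^ 2 = 1) :
    ∑ k, σ k * (u k - ∑ a, σ a * u a) ^ 2 ≤ min (⨆ k, σ k) (1 - ∑ k, σ k ^ 2) := by
  refine le_min ?_ ?_
  · have hr (s : ℝ) : ∑ k, σ k * (u k - s) ^ 2
        = ∑ k, σ k * u k ^ 2 - 2 * s * ∑ a, σ a * u a + s ^ 2 * ∑ k, σ k := by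
      rw [Finset.mul_sum, Finset.mul_sum, ← Finset.sum_sub_distrib, ← Finset.sum_add_distrib]
      exact Finset.sum_congr rfl fun k _ => by ring
    have hmax : ∑ k, σ k * u k ^ 2 ≤ ⨆ k, σ k := by
      calc ∑ k, σ k * u k ^ 2 ≤ ∑ k, (⨆ k, σ k) * u k ^ 2 :=
            Finset.sum_le_sum fun k _ => mul_le_mul_of_nonneg_right
              (le_ciSup (Set.finite_range σ).bddAbove k) (sq_nonneg _)
        _ = ⨆ k, σ k := by rw [← Finset.mul_sum, hu, mul_one]
    rw [sum_mul_sub_mean_sq hσ]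
    exact (sub_le_self _ (sq_nonneg _)).trans hmax
  · calc ∑ k, σ k * (u k - ∑ a, σ a * u a) ^ 2
        ≤ ∑ k, σ k * (1 - 2 * σ k + ∑ a, σ a ^ 2) :=
          Finset.sum_le_sum fun k _ => mul_le_mul_of_nonneg_left (sq_sub_mean_le σ hu k) (h0 k)
      _ = ∑ k, σ k - 2 * ∑ k, σ k ^ 2 + (∑ k, σ k) * ∑ a, σ a ^ 2 := by
          rw [Finset.mul_sum, Finset.sum_mul, ← Finset.sum_sub_distrib, ← Finset.sum_add_distrib]
          exact Finset.sum_congr rfl fun k _ => by ring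
      _ = 1 - ∑ k, σ k ^ 2 := by rw [hσ]; ring

lemma quartic_form_catK4 {C : ℕ} (σ u : Fin C → ℝ) :
    ∑ a, ∑ b, ∑ c, ∑ d, u a * u b * u c * u d * catK4 σ a b c d
      = ∑ k, σ k * (u k - ∑ a, σ a * u a) ^ 4 := by
  have hpow (k : Fin C) : σ k * (u k - ∑ a, σ a * u a) ^ 4
      = ∑ a, ∑ b, ∑ c, ∑ d, u a * u b * u c * u d * (σ k *
        (((if k = a then (1 : ℝ) else 0) - σ a) * ((if k = b then (1 : ℝ) else 0) - σ b) *
          ((if k = c then (1 : ℝ) else 0) - σ c) * ((if k = d then (1 : ℝ) else 0) - σ d))) := by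
    rw [← sum_mul_one_hot_sub]
    generalize hS : ∑ a, u a * ((if k = a then (1 : ℝ) else 0) - σ a) = S
    rw [show σ k * S ^ 4 = S * (S * (S * (S * σ k))) by ring, ← hS]
    rw [Finset.sum_mul]
    refine Finset.sum_congr rfl fun a _ => ?_
    rw [Finset.sum_mul, Finset.mul_sum]
    refine Finset.sum_congr rfl fun b _ => ?_
    rw [Finset.sum_mul, Finset.mul_sum, Finset.mul_sum]
    refine Finset.sum_congr rfl fun c _ => ?_
    rw [Finset.sum_mul, Finset.mul_sum, Finset.mul_sum, Finset.mul_sum]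
    exact Finset.sum_congr rfl fun d _ => by ring
  simp only [hpow, catK4, Finset.mul_sum]
  conv_rhs => rw [Finset.sum_comm]
  refine Finset.sum_congr rfl fun a _ => ?_
  conv_rhs => rw [Finset.sum_comm]
  refine Finset.sum_congr rfl fun b _ => ?_
  conv_rhs => rw [Finset.sum_comm]
  exact Finset.sum_congr rfl fun c _ => Finset.sum_comm

lemma quartic_form_prod {C : ℕ} (A : Matrix (Fin C) (Fin C) ℝ) (u : Fin C → ℝ) :
    ∑ a, ∑ b, ∑ c, ∑ d, u a * u b * u c * u d * (A a b * A c d) = (u ⬝ᵥ (A *ᵥ u)) ^ 2 := by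
  have hA : u ⬝ᵥ (A *ᵥ u) = ∑ a, ∑ b, u a * u b * A a b := by
    simp only [dotProduct, mulVec, Finset.mul_sum]
    exact Finset.sum_congr rfl fun a _ => Finset.sum_congr rfl fun b _ => by ring
  rw [hA, sq, Finset.sum_mul]
  refine Finset.sum_congr rfl fun a _ => ?_
  rw [Finset.sum_mul]
  refine Finset.sum_congr rfl fun b _ => ?_
  rw [Finset.mul_sum]
  refine Finset.sum_congr rfl fun c _ => ?_
  rw [Finset.mul_sum]
  exact Finset.sum_congr rfl fun d _ => by ring

/-- For the categorical exponential family over `C` classes with one-hot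
sufficient statistics and logits `h(x)`, with `σ(x) = SoftMax(h(x))`,
`σ_max(x) = max_k σ_k(x)` and `m(x) = min{σ_max(x), 1 − ‖σ(x)‖₂²}`:
`λ_max(𝓘(h|x)) ≤ m(x)` and `λ̃_max(K(t|x) − 𝓘(h|x)⊗𝓘(h|x)) ≤ 2·m(x)`. -/
theorem categorical_spectrum_bounds
    {X : Type*} {C : ℕ} [NeZero C] (h : X → Fin C → ℝ) :
    ∀ x : X,
      lamMax (catCov_isHermitian (softmax (h x))) ≤
        min (⨆ k, softmax (h x) k) (1 - ∑ k, softmax (h x) k ^ 2) ∧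
      tlamMax (fun a b c d =>
          catK4 (softmax (h x)) a b c d -
            catCov (softmax (h x)) a b * catCov (softmax (h x)) c d) ≤
        2 * min (⨆ k, softmax (h x) k) (1 - ∑ k, softmax (h x) k ^ 2) := by
  intro x
  have h0 := softmax_nonneg (h x)
  have h1 := sum_softmax (h x)
  generalize softmax (h x) = σ at h0 h1 ⊢
  have hS := sum_sq_le_one h0 h1
  have hm : 0 ≤ min (⨆ k, σ k) (1 - ∑ k, σ k ^ 2) :=
    le_min (Real.iSup_nonneg h0) (sub_nonneg.2 hS)
  refine ⟨Real.iSup_le (fun i => ?_) hm, Real.sSup_le ?_ (by positivity)⟩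
  · have hA := catCov_isHermitian σ
    have hu : ∑ a, (hA.eigenvectorBasis i) a ^ 2 = 1 := by
      have hn := hA.eigenvectorBasis.orthonormal.1 i
      simpa [hn] using (EuclideanSpace.real_norm_sq_eq (hA.eigenvectorBasis i)).symm
    refine le_trans (le_of_eq ?_) (variance_le_min h0 h1 hu)
    rw [← dotProduct_catCov_mulVec h1, hA.eigenvalues_eq i]
    simp
  · rintro r ⟨u, hu, rfl⟩
    have hz (k : Fin C) : (u k - ∑ a, σ a * u a) ^ 2 ≤ 2 := by
      linarith [sq_sub_mean_le σ hu k, h0 k]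
    calc ∑ a, ∑ b, ∑ c, ∑ d,
          u a * u b * u c * u d * (catK4 σ a b c d - catCov σ a b * catCov σ c d)
        = ∑ k, σ k * (u k - ∑ a, σ a * u a) ^ 4 - (u ⬝ᵥ (catCov σ *ᵥ u)) ^ 2 := by
          rw [← quartic_form_catK4, ← quartic_form_prod]
          simp only [mul_sub, Finset.sum_sub_distrib]
      _ ≤ ∑ k, σ k * (u k - ∑ a, σ a * u a) ^ 4 := sub_le_self _ (sq_nonneg _)
      _ ≤ ∑ k, 2 * (σ k * (u k - ∑ a, σ a * u a) ^ 2) :=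
          Finset.sum_le_sum fun k _ => by
            nlinarith [mul_le_mul_of_nonneg_left (hz k)
              (mul_nonneg (h0 k) (sq_nonneg (u k - ∑ a, σ a * u a)))]
      _ ≤ 2 * min (⨆ k, σ k) (1 - ∑ k, σ k ^ 2) := by
          rw [← Finset.mul_sum]
          exact mul_le_mul_of_nonneg_left (variance_le_min h0 h1 hu) zero_le_two

end FIMPaper
end
end

section
/- Given N i.i.d. samples y_1,…,y_N ~ p(y|x), the two diagonal FIM estimators Î₁(θ_i|x) = (1/N)Σ_k(∂_i F(h(x)) − ∂_i h(x)ᵀ t(y_k))² and Î₂(θ_i|x) = (1/N)Σ_k(∂²_{ii} F(h(x)) − ∂²_{ii} h(x)ᵀ t(y_k)) have variances given in closed form by Var(Î₁(θ_i|x)) = (1/N)·Σ_{abcd} ∂_i h^a(x) ∂_i h^b(x) ∂_i h^c(x) ∂_i h^d(x)·( K_{abcd}(t|x) − 𝓘_{ab}(h|x)·𝓘_{cd}(h|x) ) and Var(Î₂(θ_i|x)) = (1/N)·∂²_{ii}h(x)ᵀ 𝓘(h|x) ∂²_{ii}h(x). -/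
open MeasureTheory ProbabilityTheory Matrix

noncomputable section

namespace FIMPaper

variable {Y : Type*} [MeasurableSpace Y] {T : ℕ}

/-- The variance of the empirical mean of `N` i.i.d. samples is `N⁻¹` times the variance of one. -/
lemma variance_sampleMean_pi {N : ℕ} (hN : 0 < N) (μ : Measure Y) [IsProbabilityMeasure μ]
    {f : Y → ℝ} (hf : MemLp f 2 μ) :
    variance (fun ys : Fin N → Y => (N : ℝ)⁻¹ * ∑ k, f (ys k)) (Measure.pi fun _ => μ) =
      (N : ℝ)⁻¹ * variance f μ := by
  have h := variance_sum_pi (ι := Fin N) (μ := fun _ => μ) (X := fun _ => f) fun _ => hf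
  have hsum : (∑ i : Fin N, fun ω : Fin N → Y => f (ω i)) = fun ω => ∑ i, f (ω i) := by
    ext ω
    simp
  rw [hsum, Finset.sum_const, Finset.card_univ, Fintype.card_fin, nsmul_eq_mul] at h
  have hN' : (N : ℝ) ≠ 0 := by positivity
  rw [variance_const_mul, h]
  field_simp

lemma sum_mul_sq_eq {ι : Type*} [Fintype ι] (u v : ι → ℝ) :
    (∑ a, u a * v a) ^ 2 = ∑ a, ∑ b, u a * u b * (v a * v b) := by
  rw [sq, Finset.sum_mul_sum]
  exact Finset.sum_congr rfl fun a _ => Finset.sum_congr rfl fun b _ => by ring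

lemma sum_sum_sq_eq {ι : Type*} [Fintype ι] (u : ι → ℝ) (w : ι → ι → ℝ) :
    (∑ a, ∑ b, u a * u b * w a b) ^ 2 =
      ∑ a, ∑ b, ∑ c, ∑ d, u a * u b * u c * u d * (w a b * w c d) := by
  rw [sq, Finset.sum_mul]
  refine Finset.sum_congr rfl fun a _ => ?_
  rw [Finset.sum_mul]
  refine Finset.sum_congr rfl fun b _ => ?_
  rw [Finset.mul_sum]
  refine Finset.sum_congr rfl fun c _ => ?_
  rw [Finset.mul_sum]
  exact Finset.sum_congr rfl fun d _ => by ring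

lemma sum_mul_pow_four_eq {ι : Type*} [Fintype ι] (u v : ι → ℝ) :
    ((∑ a, u a * v a) ^ 2) ^ 2 =
      ∑ a, ∑ b, ∑ c, ∑ d, u a * u b * u c * u d * (v a * v b * v c * v d) := by
  rw [sum_mul_sq_eq, sum_sum_sq_eq u fun a b => v a * v b]
  simp only [mul_assoc]

/-- The linear form `u` applied to the centred sufficient statistic. -/
def centredForm (μ : Measure Y) (t : Y → Fin T → ℝ) (u : Fin T → ℝ) (y : Y) : ℝ :=
  ∑ a, u a * (t y a - meanT μ t a)

lemma centredForm_eq (μ : Measure Y) (t : Y → Fin T → ℝ) (u : Fin T → ℝ) (y : Y) :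
    centredForm μ t u y = ∑ a, u a * t y a - ∑ a, meanT μ t a * u a := by
  simp only [centredForm, mul_sub, Finset.sum_sub_distrib, mul_comm (u _) (meanT μ t _)]

lemma measurable_centredForm {μ : Measure Y} {t : Y → Fin T → ℝ} (ht : Measurable t)
    (u : Fin T → ℝ) : Measurable (centredForm μ t u) :=
  Finset.measurable_sum _ fun a _ =>
    (((measurable_pi_apply a).comp ht).sub_const _).const_mul (u a)

section Moments

variable {μ : Measure Y} {t : Y → Fin T → ℝ}

lemma integral_centredForm [IsProbabilityMeasure μ]
    (ht1 : ∀ a : Fin T, Integrable (fun y => t y a) μ) (u : Fin T → ℝ) :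
    ∫ y, centredForm μ t u y ∂μ = 0 := by
  have hi : ∀ a, Integrable (fun y => u a * (t y a - meanT μ t a)) μ := fun a =>
    ((ht1 a).sub (integrable_const _)).const_mul _
  unfold centredForm
  rw [integral_finsetSum _ fun a _ => hi a]
  refine Finset.sum_eq_zero fun a _ => ?_
  rw [integral_const_mul, integral_sub (ht1 a) (integrable_const _)]
  simp [meanT]

lemma integrable_centredForm_sq
    (ht2 : ∀ a b : Fin T, Integrable (fun y =>
      (t y a - meanT μ t a) * (t y b - meanT μ t b)) μ) (u : Fin T → ℝ) :
    Integrable (fun y => centredForm μ t u y ^ 2) μ := by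
  simp only [centredForm, sum_mul_sq_eq]
  exact integrable_finsetSum _ fun a _ => integrable_finsetSum _ fun b _ =>
    (ht2 a b).const_mul _

lemma integral_centredForm_sq
    (ht2 : ∀ a b : Fin T, Integrable (fun y =>
      (t y a - meanT μ t a) * (t y b - meanT μ t b)) μ) (u : Fin T → ℝ) :
    ∫ y, centredForm μ t u y ^ 2 ∂μ = ∑ a, ∑ b, u a * u b * covT μ t a b := by
  simp only [centredForm, sum_mul_sq_eq]
  rw [integral_finsetSum _ fun a _ => integrable_finsetSum _ fun b _ => (ht2 a b).const_mul _]
  refine Finset.sum_congr rfl fun a _ => ?_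
  rw [integral_finsetSum _ fun b _ => (ht2 a b).const_mul _]
  exact Finset.sum_congr rfl fun b _ => integral_const_mul _ _

lemma integrable_centredForm_pow_four
    (ht4 : ∀ a b c d : Fin T, Integrable (fun y =>
      (t y a - meanT μ t a) * (t y b - meanT μ t b) *
      (t y c - meanT μ t c) * (t y d - meanT μ t d)) μ) (u : Fin T → ℝ) :
    Integrable (fun y => (centredForm μ t u y ^ 2) ^ 2) μ := by
  simp only [centredForm, sum_mul_pow_four_eq]
  exact integrable_finsetSum _ fun a _ => integrable_finsetSum _ fun b _ =>
    integrable_finsetSum _ fun c _ => integrable_finsetSum _ fun d _ =>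
      (ht4 a b c d).const_mul _

lemma integral_centredForm_pow_four
    (ht4 : ∀ a b c d : Fin T, Integrable (fun y =>
      (t y a - meanT μ t a) * (t y b - meanT μ t b) *
      (t y c - meanT μ t c) * (t y d - meanT μ t d)) μ) (u : Fin T → ℝ) :
    ∫ y, (centredForm μ t u y ^ 2) ^ 2 ∂μ =
      ∑ a, ∑ b, ∑ c, ∑ d, u a * u b * u c * u d * K4 μ t a b c d := by
  simp only [centredForm, sum_mul_pow_four_eq]
  rw [integral_finsetSum _ fun a _ => integrable_finsetSum _ fun b _ =>
    integrable_finsetSum _ fun c _ => integrable_finsetSum _ fun d _ =>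
      (ht4 a b c d).const_mul _]
  refine Finset.sum_congr rfl fun a _ => ?_
  rw [integral_finsetSum _ fun b _ => integrable_finsetSum _ fun c _ =>
    integrable_finsetSum _ fun d _ => (ht4 a b c d).const_mul _]
  refine Finset.sum_congr rfl fun b _ => ?_
  rw [integral_finsetSum _ fun c _ => integrable_finsetSum _ fun d _ =>
    (ht4 a b c d).const_mul _]
  refine Finset.sum_congr rfl fun c _ => ?_
  rw [integral_finsetSum _ fun d _ => (ht4 a b c d).const_mul _]
  exact Finset.sum_congr rfl fun d _ => integral_const_mul _ _

end Moments

/-- Closed forms of the variances of the two conditional diagonal FIM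
estimators based on `N` i.i.d. samples `y_1,…,y_N ~ p(y|x) = μ`:
`Var(Î₁(θ_i|x)) = (1/N)∑_{abcd} ∂_i h^a ∂_i h^b ∂_i h^c ∂_i h^d (K_{abcd}(t|x) − 𝓘_{ab}𝓘_{cd})`
and `Var(Î₂(θ_i|x)) = (1/N)·∂²_{ii}h(x)ᵀ 𝓘(h|x) ∂²_{ii}h(x)`, where
`Î₁(θ_i|x) = (1/N)∑_k (∂_i F(h(x)) − ∂_i h(x)ᵀ t(y_k))²`,
`Î₂(θ_i|x) = (1/N)∑_k (∂²_{ii} F(h(x)) − ∂²_{ii} h(x)ᵀ t(y_k))`, using the exponential family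
facts `∂_i F(h(x)) = η(x)ᵀ∂_i h(x)` and
`∂²_{ii}F(h(x)) = η(x)ᵀ∂²_{ii}h(x) + ∂_i h(x)ᵀ 𝓘(h|x) ∂_i h(x)`.
Here `dh a = ∂_i h^a(x)`, `d2h a = ∂²_{ii} h^a(x)`, `dF = ∂_i F(h(x))`,
`d2F = ∂²_{ii} F(h(x))` for the fixed input `x` and parameter index `i`. -/
theorem conditional_variances_closed_form
    {Y : Type*} [MeasurableSpace Y] {T N : ℕ} (hN : 0 < N)
    (μ : Measure Y) (hμ : IsProbabilityMeasure μ)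
    (t : Y → Fin T → ℝ) (ht : Measurable t)
    (ht1 : ∀ a : Fin T, Integrable (fun y => t y a) μ)
    (ht2 : ∀ a b : Fin T, Integrable (fun y =>
      (t y a - meanT μ t a) * (t y b - meanT μ t b)) μ)
    (ht4 : ∀ a b c d : Fin T, Integrable (fun y =>
      (t y a - meanT μ t a) * (t y b - meanT μ t b) *
      (t y c - meanT μ t c) * (t y d - meanT μ t d)) μ)
    (dh d2h : Fin T → ℝ) (dF d2F : ℝ)
    (hdF : dF = ∑ a, meanT μ t a * dh a)
    (hd2F : d2F = (∑ a, meanT μ t a * d2h a) + ∑ a, ∑ b, dh a * covT μ t a b * dh b) :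
    variance
        (fun ys : Fin N → Y => (N : ℝ)⁻¹ * ∑ k, (dF - ∑ a, dh a * t (ys k) a) ^ 2)
        (Measure.pi fun _ => μ) =
      (N : ℝ)⁻¹ * ∑ a, ∑ b, ∑ c, ∑ d,
        dh a * dh b * dh c * dh d *
          (K4 μ t a b c d - covT μ t a b * covT μ t c d) ∧
    variance
        (fun ys : Fin N → Y => (N : ℝ)⁻¹ * ∑ k, (d2F - ∑ a, d2h a * t (ys k) a))
        (Measure.pi fun _ => μ) =
      (N : ℝ)⁻¹ * ∑ a, ∑ b, d2h a * covT μ t a b * d2h b := by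
  constructor
  · have hf : ∀ y, (dF - ∑ a, dh a * t y a) ^ 2 = centredForm μ t dh y ^ 2 := fun y => by
      rw [centredForm_eq, hdF]
      ring
    have hL2 : MemLp (fun y => centredForm μ t dh y ^ 2) 2 μ :=
      (memLp_two_iff_integrable_sq
        ((measurable_centredForm ht dh).pow_const 2).aestronglyMeasurable).2
        (integrable_centredForm_pow_four ht4 dh)
    simp only [hf]
    rw [variance_sampleMean_pi hN μ hL2, variance_eq_sub hL2]
    simp only [Pi.pow_apply]
    rw [integral_centredForm_pow_four ht4, integral_centredForm_sq ht2,
      sum_sum_sq_eq dh fun a b => covT μ t a b]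
    simp only [mul_sub, Finset.sum_sub_distrib]
  · have hf : ∀ y, d2F - ∑ a, d2h a * t y a =
        (∑ a, ∑ b, dh a * covT μ t a b * dh b) - centredForm μ t d2h y := fun y => by
      rw [centredForm_eq, hd2F]
      ring
    have hm := (measurable_centredForm (μ := μ) ht d2h).aestronglyMeasurable (μ := μ)
    have hL2 : MemLp (centredForm μ t d2h) 2 μ :=
      (memLp_two_iff_integrable_sq hm).2 (integrable_centredForm_sq ht2 d2h)
    have hL2' : MemLp (fun y => (∑ a, ∑ b, dh a * covT μ t a b * dh b) -
        centredForm μ t d2h y) 2 μ := (memLp_const _).sub hL2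
    simp only [hf]
    rw [variance_sampleMean_pi hN μ hL2', variance_const_sub hm,
      variance_of_integral_eq_zero hm.aemeasurable (integral_centredForm ht1 d2h),
      integral_centredForm_sq ht2]
    simp only [mul_right_comm (d2h _) (d2h _)]

end FIMPaper
end
end
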